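/- Let S be a board. Call a vertex v of S positive if exactly one of the four cells v, v−(1,0), v−(0,1), v−(1,1) lies in S and that cell is v or v−(1,1); call v negative if exactly three of these four cells lie in S and the missing one is v or v−(1,1). (These are exactly the boundary vertices at which the function x+y restricted to the boundary of R(S) has a local extremum, the positive ones being corners.) Then (number of positive vertices of S) − (number of negative vertices of S) = 2. -/

import Mathlib

open scoped Matrix

/-- A cell of the integer grid, representing the closed unit square
`[p₁, p₁+1] × [p₂, p₂+1] ⊆ ℝ²`. -/
abbrev Cell : Type := ℤ × ℤ

/-- The closed unit square in `ℝ²` corresponding to a cell. -/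
def unitSquare (p : Cell) : Set (ℝ × ℝ) :=
  (Set.Icc (p.1 : ℝ) ((p.1 : ℝ) + 1)) ×ˢ (Set.Icc (p.2 : ℝ) ((p.2 : ℝ) + 1))

/-- The region of the plane covered by a finite set of cells. -/
def Region (S : Finset Cell) : Set (ℝ × ℝ) := ⋃ p ∈ S, unitSquare p

/-- A board: a finite nonempty set of cells whose region is homeomorphic to the
closed unit disk in `ℝ²`. -/
def IsBoard (S : Finset Cell) : Prop :=
  S.Nonempty ∧
    Nonempty ((Region S) ≃ₜ (Metric.closedBall (0 : EuclideanSpace ℝ (Fin 2)) 1))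

/-- A cell is black if the sum of its coordinates is even. -/
def IsBlackCell (p : Cell) : Prop := Even (p.1 + p.2)

instance (p : Cell) : Decidable (IsBlackCell p) := by
  unfold IsBlackCell; infer_instance

/-- The black cells of `S`. -/
def blackCells (S : Finset Cell) : Finset Cell := S.filter IsBlackCell

/-- The white cells of `S`. -/
def whiteCells (S : Finset Cell) : Finset Cell := S.filter fun p => ¬ IsBlackCell p

/-- Two cells are adjacent when they share an edge. -/
def Adjacent (p q : Cell) : Prop :=
  p - q = (1, 0) ∨ p - q = (-1, 0) ∨ p - q = (0, 1) ∨ p - q = (0, -1)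

instance (p q : Cell) : Decidable (Adjacent p q) := by
  unfold Adjacent; infer_instance

/-- The black-to-white adjacency matrix of a set of cells, with respect to
labelings `β` of the black cells and `ω` of the white cells. -/
def btwMatrix {S : Finset Cell} {b w : ℕ}
    (β : Fin b ≃ blackCells S) (ω : Fin w ≃ whiteCells S) :
    Matrix (Fin b) (Fin w) ℤ :=
  fun i j => if Adjacent (β i : Cell) (ω j : Cell) then 1 else 0

/-- The four vertices of a cell. -/
def cellVerts (p : Cell) : Finset Cell := {p, p + (1, 0), p + (0, 1), p + (1, 1)}

/-- `v` is a vertex of `S` if it is a vertex of some cell of `S`. -/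
def IsVertex (S : Finset Cell) (v : Cell) : Prop := ∃ p ∈ S, v ∈ cellVerts p

/-- The cells of `S` incident to the vertex `v`. -/
def incidentCells (S : Finset Cell) (v : Cell) : Finset Cell :=
  S.filter fun p => v ∈ cellVerts p

/-- The point of `ℝ²` corresponding to a grid point. -/
def toR (v : Cell) : ℝ × ℝ := ((v.1 : ℝ), (v.2 : ℝ))

/-- A boundary vertex of `S`: a vertex lying in the topological frontier of the
region of `S`. -/
def IsBoundaryVertex (S : Finset Cell) (v : Cell) : Prop :=
  IsVertex S v ∧ toR v ∈ frontier (Region S)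

/-- An interior vertex of `S`: a vertex not lying in the frontier of the region
of `S`. -/
def IsInteriorVertex (S : Finset Cell) (v : Cell) : Prop :=
  IsVertex S v ∧ toR v ∉ frontier (Region S)

/-- A corner of `S`: a vertex incident to exactly one cell of `S`. -/
def IsBoardCorner (S : Finset Cell) (v : Cell) : Prop := (incidentCells S v).card = 1

/-- `a` and `b` are opposite vertices of the cell `q`. -/
def OppositeVerts (q a b : Cell) : Prop :=
  ({a, b} : Finset Cell) = {q, q + (1, 1)} ∨
    ({a, b} : Finset Cell) = {q + (1, 0), q + (0, 1)}

/-- A pre-diagonal of `S` of length `k`: vertices `v 0, …, v k` and cells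
`s 0, …, s (k-1)` as in the definition of a diagonal.  (The values of `v` at
indices `> k` and of `s` at indices `≥ k` are irrelevant.) -/
def IsPreDiagonal (S : Finset Cell) (k : ℕ) (v : ℕ → Cell) (s : ℕ → Cell) : Prop :=
  1 ≤ k ∧
  IsBoardCorner S (v 0) ∧
  (∀ i, 0 < i → i < k → IsInteriorVertex S (v i)) ∧
  (∀ i, i < k → s i ∈ S) ∧
  (∀ i, i < k → OppositeVerts (s i) (v i) (v (i + 1))) ∧
  (∀ i, i + 1 < k → (cellVerts (s i) ∩ cellVerts (s (i + 1))).card = 1) ∧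
  (∀ i j, i ≤ k → j ≤ k → i ≠ j → v i ≠ v j) ∧
  (∀ i j, i < k → j < k → i ≠ j → s i ≠ s j)

/-- The pre-diagonal `(k', v', s')` extends the pre-diagonal `(k, v, s)`. -/
def PreDiagExtends (k' : ℕ) (v' s' : ℕ → Cell) (k : ℕ) (v s : ℕ → Cell) : Prop :=
  k ≤ k' ∧ (∀ i ≤ k, v' i = v i) ∧ (∀ i < k, s' i = s i)

/-- A diagonal: a pre-diagonal that is maximal under extension. -/
def IsDiagonal (S : Finset Cell) (k : ℕ) (v s : ℕ → Cell) : Prop :=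
  IsPreDiagonal S k v s ∧
    ∀ k' v' s', IsPreDiagonal S k' v' s' → PreDiagExtends k' v' s' k v s → k' = k

/-- A good diagonal: at least one of the two unit edges of the last cell
`s (k-1)` containing the final vertex `v k` is contained in the frontier of the
region of `S`. -/
def IsGoodDiagonal (S : Finset Cell) (k : ℕ) (v s : ℕ → Cell) : Prop :=
  IsDiagonal S k v s ∧
    ∃ a ∈ cellVerts (s (k - 1)),
      (a - v k = (1, 0) ∨ a - v k = (0, 1) ∨ a - v k = (-1, 0) ∨ a - v k = (0, -1)) ∧
      segment ℝ (toR (v k)) (toR a) ⊆ frontier (Region S)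

/-- A positive vertex of `S`: exactly one of the four cells around `v` lies in
`S`, and it is `v` or `v - (1,1)`. -/
def IsPositiveVertex (S : Finset Cell) (v : Cell) : Prop :=
  (incidentCells S v).card = 1 ∧ (v ∈ S ∨ v - (1, 1) ∈ S)

/-- A negative vertex of `S`: exactly three of the four cells around `v` lie in
`S`, and the missing one is `v` or `v - (1,1)`. -/
def IsNegativeVertex (S : Finset Cell) (v : Cell) : Prop :=
  (incidentCells S v).card = 3 ∧ (v ∉ S ∨ v - (1, 1) ∉ S)


lemma bd_count (T V : Finset Cell) (t : Cell) (h : ∀ e ∈ T, e + t ∈ V) :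
    (T.card : ℤ) = ∑ v ∈ V, if v - t ∈ T then 1 else 0 := by
  rw [← Finset.sum_filter, Finset.sum_const, nsmul_eq_mul, mul_one]
  congr 1
  have : V.filter (fun v => v - t ∈ T) = T.image (fun e => e + t) := by
    ext v
    simp only [Finset.mem_filter, Finset.mem_image]
    constructor
    · rintro ⟨_, h2⟩
      exact ⟨_, h2, by simp⟩
    · rintro ⟨e, he, rfl⟩
      exact ⟨h e he, by simpa using he⟩
  rw [this, Finset.card_image_of_injective _ (add_left_injective t)]

/-- vertices of the board -/
def bdV (S : Finset Cell) : Finset Cell := S.biUnion cellVerts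
/-- horizontal edges, named by left endpoint -/
def bdH (S : Finset Cell) : Finset Cell := S ∪ S.image (fun p => p + (0, 1))
/-- vertical edges, named by lower endpoint -/
def bdK (S : Finset Cell) : Finset Cell := S ∪ S.image (fun p => p + (1, 0))

lemma mem_bdH {S : Finset Cell} {v : Cell} : v ∈ bdH S ↔ v ∈ S ∨ v - (0, 1) ∈ S := by
  simp only [bdH, Finset.mem_union, Finset.mem_image]
  constructor
  · rintro (h | ⟨e, he, rfl⟩)
    · exact Or.inl h
    · exact Or.inr (by simpa using he)
  · rintro (h | h)
    · exact Or.inl h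
    · exact Or.inr ⟨_, h, by simp⟩

lemma mem_bdK {S : Finset Cell} {v : Cell} : v ∈ bdK S ↔ v ∈ S ∨ v - (1, 0) ∈ S := by
  simp only [bdK, Finset.mem_union, Finset.mem_image]
  constructor
  · rintro (h | ⟨e, he, rfl⟩)
    · exact Or.inl h
    · exact Or.inr (by simpa using he)
  · rintro (h | h)
    · exact Or.inl h
    · exact Or.inr ⟨_, h, by simp⟩

lemma mem_cellVerts_iff {v p : Cell} : v ∈ cellVerts p ↔
    p = v ∨ p = v - (1, 0) ∨ p = v - (0, 1) ∨ p = v - (1, 1) := by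
  simp only [cellVerts, Finset.mem_insert, Finset.mem_singleton, eq_sub_iff_add_eq]
  constructor <;> rintro (h | h | h | h) <;> simp [h]

lemma mem_bdV {S : Finset Cell} {v : Cell} : v ∈ bdV S ↔
    v ∈ S ∨ v - (1, 0) ∈ S ∨ v - (0, 1) ∈ S ∨ v - (1, 1) ∈ S := by
  simp only [bdV, Finset.mem_biUnion, mem_cellVerts_iff]
  constructor
  · rintro ⟨p, hp, rfl | rfl | rfl | rfl⟩ <;> simp [hp]
  · rintro (h | h | h | h)
    · exact ⟨_, h, by simp⟩
    · exact ⟨_, h, by simp⟩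
    · exact ⟨_, h, by simp⟩
    · exact ⟨_, h, by simp⟩

lemma card_incident (S : Finset Cell) (v : Cell) : (incidentCells S v).card =
    (if v ∈ S then 1 else 0) + (if v - (1, 0) ∈ S then 1 else 0)
      + (if v - (0, 1) ∈ S then 1 else 0) + (if v - (1, 1) ∈ S then 1 else 0) := by
  have : incidentCells S v =
      ({v, v - (1, 0), v - (0, 1), v - (1, 1)} : Finset Cell).filter (· ∈ S) := by
    ext p
    simp only [incidentCells, Finset.mem_filter, mem_cellVerts_iff, Finset.mem_insert,
      Finset.mem_singleton]
    tauto
  rw [this, Finset.card_filter, Finset.sum_insert, Finset.sum_insert, Finset.sum_insert,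
    Finset.sum_singleton]
  · ring
  all_goals simp [Prod.ext_iff]
  omega

lemma combinatorial_count (S : Finset Cell)
    (hpinch : ∀ v : Cell, v - (1, 0) ∈ S → v - (0, 1) ∈ S → v ∉ S → v - (1, 1) ∉ S → False) :
    ({v : Cell | IsPositiveVertex S v}.ncard : ℤ)
      - ({v : Cell | IsNegativeVertex S v}.ncard : ℤ) =
    2 * ((bdV S).card - (bdH S).card - (bdK S).card + S.card : ℤ) := by
  classical
  have hP : {v : Cell | IsPositiveVertex S v} = ↑((bdV S).filter (IsPositiveVertex S)) := by
    ext v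
    simp only [Set.mem_ofPred_eq, Finset.coe_filter, iff_and_self]
    rintro ⟨_, h⟩
    rw [mem_bdV]; tauto
  have hN : {v : Cell | IsNegativeVertex S v} = ↑((bdV S).filter (IsNegativeVertex S)) := by
    ext v
    simp only [Set.mem_ofPred_eq, Finset.coe_filter, iff_and_self]
    rintro ⟨h, _⟩
    rw [card_incident] at h
    rw [mem_bdV]
    by_contra hc
    push Not at hc
    simp [hc] at h
  rw [hP, hN, Set.ncard_coe_finset, Set.ncard_coe_finset, Finset.card_filter, Finset.card_filter]
  have sub : ∀ v : Cell, ∀ t ∈ ({0, (1,0), (0,1), (1,1)} : Finset Cell), v ∈ S → v + t ∈ bdV S := by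
    intro v t ht hv
    rw [mem_bdV]
    simp only [Finset.mem_insert, Finset.mem_singleton] at ht
    rcases ht with rfl | rfl | rfl | rfl <;> simp [hv]
  have h1 := bd_count (bdH S) (bdV S) 0 (by
    intro e he; rw [mem_bdH] at he; rw [mem_bdV]; simp; tauto)
  have h2 := bd_count (bdH S) (bdV S) (1, 0) (by
    intro e he; rw [mem_bdH] at he; rw [mem_bdV]
    have : e + (1, 0) - (1, 1) = e - (0, 1) := by ext <;> simp
    rw [this]; simp; tauto)
  have h3 := bd_count (bdK S) (bdV S) 0 (by
    intro e he; rw [mem_bdK] at he; rw [mem_bdV]; simp; tauto)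
  have h4 := bd_count (bdK S) (bdV S) (0, 1) (by
    intro e he; rw [mem_bdK] at he; rw [mem_bdV]
    have : e + (0, 1) - (1, 1) = e - (1, 0) := by ext <;> simp
    rw [this]; simp; tauto)
  have h5 := bd_count S (bdV S) 0 (fun e he => sub e 0 (by simp) he)
  have h6 := bd_count S (bdV S) (1, 1) (fun e he => sub e _ (by simp) he)
  have h7 : ((bdV S).card : ℤ) = ∑ v ∈ bdV S, 1 := by simp
  have key : 2 * ((bdV S).card - (bdH S).card - (bdK S).card + S.card : ℤ) =
      2 * ((bdV S).card : ℤ) - (bdH S).card - (bdH S).card - (bdK S).card - (bdK S).card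
        + S.card + S.card := by ring
  rw [key]
  nth_rewrite 1 [h1]
  nth_rewrite 1 [h2]
  nth_rewrite 1 [h3]
  nth_rewrite 1 [h4]
  nth_rewrite 1 [h5]
  nth_rewrite 1 [h6]
  rw [h7, Finset.mul_sum]
  push_cast
  simp only [← Finset.sum_sub_distrib, ← Finset.sum_add_distrib]
  refine Finset.sum_congr rfl fun v hv => ?_
  have hp := hpinch v
  rw [mem_bdV] at hv
  have e1 : v - (1, 0) - (0, 1) = v - (1, 1) := by ext <;> simp
  have e2 : v - (0, 1) - (1, 0) = v - (1, 1) := by ext <;> simp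
  simp only [IsPositiveVertex, IsNegativeVertex, card_incident, mem_bdH, mem_bdK, sub_zero, e1, e2]
  by_cases a : v ∈ S <;> by_cases b : v - (1, 0) ∈ S <;> by_cases c : v - (0, 1) ∈ S <;>
    by_cases d : v - (1, 1) ∈ S <;> simp [a, b, c, d] at hv hp ⊢

/-- extension by zero -/
def bdExt {T : Finset Cell} (f : T → ℤ) (v : Cell) : ℤ := if h : v ∈ T then f ⟨v, h⟩ else 0

lemma bdExt_mem {T : Finset Cell} (f : T → ℤ) {v : Cell} (h : v ∈ T) : bdExt f v = f ⟨v, h⟩ := by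
  simp [bdExt, h]

lemma bdExt_add {T : Finset Cell} (f g : T → ℤ) (v : Cell) :
    bdExt (f + g) v = bdExt f v + bdExt g v := by
  unfold bdExt; split_ifs <;> simp

lemma bdExt_smul {T : Finset Cell} (c : ℤ) (f : T → ℤ) (v : Cell) :
    bdExt (c • f) v = c * bdExt f v := by
  unfold bdExt; split_ifs <;> simp

/-- first coboundary -/
def bdD0 (S : Finset Cell) : (bdV S → ℤ) →ₗ[ℤ] (bdH S → ℤ) × (bdK S → ℤ) where
  toFun f := (fun e => bdExt f (e.1 + (1, 0)) - bdExt f e.1,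
    fun e => bdExt f (e.1 + (0, 1)) - bdExt f e.1)
  map_add' f g := by
    ext e <;> simp [bdExt_add] <;> ring
  map_smul' c f := by
    ext e <;> simp only [bdExt_smul] <;> simp <;> ring

/-- second coboundary -/
def bdD1 (S : Finset Cell) : (bdH S → ℤ) × (bdK S → ℤ) →ₗ[ℤ] (S → ℤ) where
  toFun f := fun p => bdExt f.1 p.1 + bdExt f.2 (p.1 + (1, 0)) - bdExt f.1 (p.1 + (0, 1))
    - bdExt f.2 p.1
  map_add' f g := by
    ext e; simp [bdExt_add]; ring
  map_smul' c f := by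
    ext e; simp only [Prod.smul_fst, Prod.smul_snd, bdExt_smul]; simp; ring

lemma bdD1_surj (S : Finset Cell) : LinearMap.range (bdD1 S) = ⊤ := by
  rw [LinearMap.range_eq_top]
  intro g
  refine ⟨(0, fun e => ∑ q ∈ S with q.2 = e.1.2 ∧ q.1 < e.1.1, bdExt g q), ?_⟩
  ext ⟨p, hp⟩
  have h1 : p ∈ bdK S := mem_bdK.2 (Or.inl hp)
  have h2 : p + (1, 0) ∈ bdK S := mem_bdK.2 (Or.inr (by simpa using hp))
  have h0 : ∀ v, bdExt (0 : bdH S → ℤ) v = 0 := by intro v; simp [bdExt]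
  simp only [bdD1, LinearMap.coe_mk, AddHom.coe_mk, h0, bdExt_mem _ h1, bdExt_mem _ h2]
  have : S.filter (fun q => q.2 = (p + (1, 0)).2 ∧ q.1 < (p + (1, 0)).1) =
      insert p (S.filter (fun q => q.2 = p.2 ∧ q.1 < p.1)) := by
    ext q
    simp only [Finset.mem_filter, Finset.mem_insert, Prod.fst_add, Prod.snd_add, Prod.ext_iff]
    constructor
    · rintro ⟨h, h', h''⟩
      by_cases hq : q.1 = p.1
      · left; exact ⟨hq, by omega⟩
      · right; exact ⟨h, by omega, by omega⟩
    · rintro (⟨h, h'⟩ | ⟨h, h', h''⟩)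
      · have : q = p := Prod.ext h h'
        subst this
        exact ⟨hp, by omega, by omega⟩
      · exact ⟨h, by omega, by omega⟩
  rw [this, Finset.sum_insert (by simp), bdExt_mem _ hp]
  ring

lemma bd_rank_nullity {M N : Type} [AddCommGroup M] [AddCommGroup N] [Module.Finite ℤ M]
    (f : M →ₗ[ℤ] N) :
    Module.finrank ℤ (LinearMap.range f) + Module.finrank ℤ (LinearMap.ker f)
      = Module.finrank ℤ M := by
  rw [← f.quotKerEquivRange.finrank_eq]
  exact Submodule.finrank_quotient_add_finrank _

lemma euler_of_exact (S : Finset Cell) (hne : S.Nonempty)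
    (hconn : ∀ f : Cell → ℤ, (∀ p ∈ S, f (p + (1, 0)) = f p ∧ f (p + (0, 1)) = f p ∧
      f (p + (1, 1)) = f p) → ∀ p ∈ S, ∀ q ∈ S, f p = f q)
    (hex : ∀ h k : Cell → ℤ, (∀ p ∈ S, h p + k (p + (1, 0)) = k p + h (p + (0, 1))) →
      ∃ g : Cell → ℤ, ∀ p ∈ S, g (p + (1, 0)) - g p = h p ∧ g (p + (0, 1)) - g p = k p ∧
        g (p + (1, 1)) - g (p + (0, 1)) = h (p + (0, 1)) ∧
        g (p + (1, 1)) - g (p + (1, 0)) = k (p + (1, 0))) :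
    ((bdV S).card - (bdH S).card - (bdK S).card + S.card : ℤ) = 1 := by
  have e1 : ∀ p : Cell, p + (0, 1) + (1, 0) = p + (1, 1) := fun p => by ext <;> simp
  have e2 : ∀ p : Cell, p + (1, 0) + (0, 1) = p + (1, 1) := fun p => by ext <;> simp
  have hk0 : LinearMap.ker (bdD0 S) = Submodule.span ℤ {(fun _ => 1 : bdV S → ℤ)} := by
    apply le_antisymm
    · intro f hf
      rw [LinearMap.mem_ker] at hf
      obtain ⟨p0, hp0⟩ := hne
      have hH : ∀ e ∈ bdH S, bdExt f (e + (1, 0)) = bdExt f e := by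
        intro e he
        have := congrFun (congrArg Prod.fst hf) ⟨e, he⟩
        simpa [bdD0, sub_eq_zero] using this
      have hK : ∀ e ∈ bdK S, bdExt f (e + (0, 1)) = bdExt f e := by
        intro e he
        have := congrFun (congrArg Prod.snd hf) ⟨e, he⟩
        simpa [bdD0, sub_eq_zero] using this
      have hcell : ∀ p ∈ S, bdExt f (p + (1, 0)) = bdExt f p ∧ bdExt f (p + (0, 1)) = bdExt f p ∧
          bdExt f (p + (1, 1)) = bdExt f p := by
        intro p hp
        have a1 := hH p (mem_bdH.2 (Or.inl hp))
        have a2 := hK p (mem_bdK.2 (Or.inl hp))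
        have a3 := hH (p + (0, 1)) (mem_bdH.2 (Or.inr (by simpa using hp)))
        rw [e1] at a3
        exact ⟨a1, a2, a3.trans a2⟩
      have hc := hconn (bdExt f) hcell
      rw [Submodule.mem_span_singleton]
      refine ⟨bdExt f p0, ?_⟩
      ext ⟨v, hv⟩
      rw [← bdExt_mem f hv]
      simp only [Pi.smul_apply, smul_eq_mul, mul_one]
      rw [mem_bdV] at hv
      rcases hv with h | h | h | h
      · exact hc _ hp0 _ h
      all_goals
        rw [hc _ hp0 _ h]
        have := hcell _ h
        simp only [sub_add_cancel] at this
        tauto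
    · rw [Submodule.span_singleton_le_iff_mem, LinearMap.mem_ker]
      ext ⟨e, he⟩
      · have h1 : e ∈ bdV S := by rw [mem_bdH] at he; rw [mem_bdV]; tauto
        have h2 : e + (1, 0) ∈ bdV S := by
          rw [mem_bdH] at he; rw [mem_bdV]
          have : e + (1, 0) - (1, 1) = e - (0, 1) := by ext <;> simp
          rw [this]; simp; tauto
        simp [bdD0, bdExt, h1, h2]
      · have h1 : e ∈ bdV S := by rw [mem_bdK] at he; rw [mem_bdV]; tauto
        have h2 : e + (0, 1) ∈ bdV S := by
          rw [mem_bdK] at he; rw [mem_bdV]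
          have : e + (0, 1) - (1, 1) = e - (1, 0) := by ext <;> simp
          rw [this]; simp; tauto
        simp [bdD0, bdExt, h1, h2]
  have hex' : LinearMap.range (bdD0 S) = LinearMap.ker (bdD1 S) := by
    apply le_antisymm
    · rintro _ ⟨f, rfl⟩
      rw [LinearMap.mem_ker]
      ext ⟨p, hp⟩
      have h1 : p ∈ bdH S := mem_bdH.2 (Or.inl hp)
      have h2 : p ∈ bdK S := mem_bdK.2 (Or.inl hp)
      have h3 : p + (0, 1) ∈ bdH S := mem_bdH.2 (Or.inr (by simpa using hp))
      have h4 : p + (1, 0) ∈ bdK S := mem_bdK.2 (Or.inr (by simpa using hp))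
      simp only [bdD0, bdD1, LinearMap.coe_mk, AddHom.coe_mk, bdExt_mem _ h1, bdExt_mem _ h2,
        bdExt_mem _ h3, bdExt_mem _ h4, e1, e2, Pi.zero_apply]
      ring
    · rintro ⟨h, k⟩ hc
      rw [LinearMap.mem_ker] at hc
      obtain ⟨g, hg⟩ := hex (bdExt h) (bdExt k) (by
        intro p hp
        have := congrFun hc ⟨p, hp⟩
        simp only [bdD1, LinearMap.coe_mk, AddHom.coe_mk, Pi.zero_apply] at this
        linarith)
      refine ⟨fun v => g v, ?_⟩
      have hgx : ∀ v ∈ bdV S, bdExt (fun v : bdV S => g v) v = g v := fun v hv => bdExt_mem _ hv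
      ext ⟨e, he⟩
      · have h1 : e ∈ bdV S := by rw [mem_bdH] at he; rw [mem_bdV]; tauto
        have h2 : e + (1, 0) ∈ bdV S := by
          rw [mem_bdH] at he; rw [mem_bdV]
          have : e + (1, 0) - (1, 1) = e - (0, 1) := by ext <;> simp
          rw [this]; simp; tauto
        simp only [bdD0, LinearMap.coe_mk, AddHom.coe_mk, hgx _ h1, hgx _ h2]
        rw [← bdExt_mem h he]
        rcases mem_bdH.1 he with hS | hS
        · exact (hg e hS).1
        · have := (hg _ hS).2.2.1
          rw [← e1] at this
          simpa using this
      · have h1 : e ∈ bdV S := by rw [mem_bdK] at he; rw [mem_bdV]; tauto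
        have h2 : e + (0, 1) ∈ bdV S := by
          rw [mem_bdK] at he; rw [mem_bdV]
          have : e + (0, 1) - (1, 1) = e - (1, 0) := by ext <;> simp
          rw [this]; simp; tauto
        simp only [bdD0, LinearMap.coe_mk, AddHom.coe_mk, hgx _ h1, hgx _ h2]
        rw [← bdExt_mem k he]
        rcases mem_bdK.1 he with hS | hS
        · exact (hg e hS).2.1
        · have := (hg _ hS).2.2.2
          rw [← e2] at this
          simpa using this
  have r0 := bd_rank_nullity (bdD0 S)
  have r1 := bd_rank_nullity (bdD1 S)
  have hone : Module.finrank ℤ (Submodule.span ℤ {(fun _ => 1 : bdV S → ℤ)}) = 1 := by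
    obtain ⟨p0, hp0⟩ := hne
    have h0 : (fun _ => 1 : bdV S → ℤ) ≠ 0 := by
      intro h
      have := congrFun h ⟨p0, mem_bdV.2 (Or.inl hp0)⟩
      simp at this
    rw [← (LinearEquiv.toSpanNonzeroSingleton ℤ (bdV S → ℤ) _ h0).finrank_eq, Module.finrank_self]
  rw [hk0, hone, hex', Module.finrank_fintype_fun_eq_card, Fintype.card_coe] at r0
  rw [bdD1_surj, finrank_top, Module.finrank_prod, Module.finrank_fintype_fun_eq_card,
    Module.finrank_fintype_fun_eq_card, Module.finrank_fintype_fun_eq_card, Fintype.card_coe,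
    Fintype.card_coe, Fintype.card_coe] at r1
  omega

lemma bd_lift {X : Type*} [TopologicalSpace X] [ContractibleSpace X]
    (F : C(X, AddCircle (1 : ℝ))) :
    ∃ G : C(X, ℝ), ∀ x, ((G x : ℝ) : AddCircle (1 : ℝ)) = F x := by
  obtain ⟨y, ⟨H⟩⟩ := (id_nullhomotopic X).comp_right F
  obtain ⟨e, he⟩ := QuotientAddGroup.mk_surjective y
  have cov := AddCircle.isCoveringMap_coe (1 : ℝ)
  have H0 : ∀ a : X, H.symm.toContinuousMap (0, a) =
      (((ContinuousMap.const X e) a : ℝ) : AddCircle (1 : ℝ)) := by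
    intro a
    have := H.symm.apply_zero a
    simp only [ContinuousMap.const_apply] at this ⊢
    exact this.trans he.symm
  refine ⟨(cov.liftHomotopy H.symm.toContinuousMap (ContinuousMap.const X e) H0).comp
    ((ContinuousMap.const X 1).prodMk (ContinuousMap.id X)), fun x => ?_⟩
  have := congrFun (cov.liftHomotopy_lifts H.symm.toContinuousMap (ContinuousMap.const X e) H0)
    (1, x)
  have h1 := H.symm.apply_one x
  exact this.trans h1

/-- bilinear interpolation on the cell `p` -/
noncomputable def bdPhi (h k : Cell → ℤ) (p : Cell) (z : ℝ × ℝ) : ℝ :=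
  h p * (z.1 - p.1) + k p * (z.2 - p.2) + (h (p + (0, 1)) - h p) * (z.1 - p.1) * (z.2 - p.2)

lemma bdPhi_cont (h k : Cell → ℤ) (p : Cell) : Continuous (bdPhi h k p) := by
  unfold bdPhi; fun_prop

/-- the glued circle-valued map -/
noncomputable def bdF (h k : Cell → ℤ) (z : ℝ × ℝ) : AddCircle (1 : ℝ) :=
  (bdPhi h k (⌊z.1⌋, ⌊z.2⌋) z : ℝ)

lemma bd_coe_eq {x y : ℝ} : ((x : AddCircle (1 : ℝ)) = (y : AddCircle (1 : ℝ))) ↔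
    ∃ n : ℤ, x - y = n := by
  rw [← sub_eq_zero, ← AddCircle.coe_sub, AddCircle.coe_eq_zero_iff]
  constructor
  · rintro ⟨n, hn⟩; exact ⟨n, by simpa using hn.symm⟩
  · rintro ⟨n, hn⟩; exact ⟨n, by simpa using hn.symm⟩

lemma bdF_eq (h k : Cell → ℤ) (p : Cell) (hp : h p + k (p + (1, 0)) = k p + h (p + (0, 1)))
    (z : ℝ × ℝ) (hz : z ∈ unitSquare p) : bdF h k z = (bdPhi h k p z : ℝ) := by
  obtain ⟨p1, p2⟩ := p
  obtain ⟨x, y⟩ := z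
  simp only [unitSquare, Set.mem_prod, Set.mem_Icc] at hz
  obtain ⟨⟨hx, hx'⟩, hy, hy'⟩ := hz
  have hpR : (h (p1, p2) : ℝ) + k (p1 + 1, p2) = k (p1, p2) + h (p1, p2 + 1) := by
    have : h (p1, p2) + k (p1 + 1, p2) = k (p1, p2) + h (p1, p2 + 1) := by simpa using hp
    exact_mod_cast this
  unfold bdF
  rw [bd_coe_eq]
  rcases hx'.lt_or_eq with hx1 | rfl <;> rcases hy'.lt_or_eq with hy1 | rfl
  · have : ⌊x⌋ = p1 := by rw [Int.floor_eq_iff]; exact ⟨hx, hx1⟩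
    have : ⌊y⌋ = p2 := by rw [Int.floor_eq_iff]; exact ⟨hy, hy1⟩
    subst_vars
    exact ⟨0, by simp⟩
  · have : ⌊x⌋ = p1 := by rw [Int.floor_eq_iff]; exact ⟨hx, hx1⟩
    subst this
    refine ⟨- k (⌊x⌋, p2), ?_⟩
    simp [bdPhi]
    ring
  · have : ⌊y⌋ = p2 := by rw [Int.floor_eq_iff]; exact ⟨hy, hy1⟩
    subst this
    refine ⟨- h (p1, ⌊y⌋), ?_⟩
    simp [bdPhi]
    rw [← Int.self_sub_floor y]
    linear_combination (y - ⌊y⌋) * hpR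
  · refine ⟨- h (p1, p2 + 1) - k (p1, p2), ?_⟩
    simp [bdPhi]
    ring

lemma unitSquare_closed (p : Cell) : IsClosed (unitSquare p) := isClosed_Icc.prod isClosed_Icc

lemma unitSquare_subset {S : Finset Cell} {p : Cell} (hp : p ∈ S) : unitSquare p ⊆ Region S :=
  Set.subset_biUnion_of_mem (u := unitSquare) hp

lemma bdF_cont (S : Finset Cell) (h k : Cell → ℤ)
    (hcl : ∀ p ∈ S, h p + k (p + (1, 0)) = k p + h (p + (0, 1))) :
    ContinuousOn (bdF h k) (Region S) := by
  have : Region S = ⋃ p : S, unitSquare p.1 := by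
    ext z; simp [Region]
  rw [this]
  refine (locallyFinite_of_finite _).continuousOn_iUnion (fun p => unitSquare_closed _) ?_
  rintro ⟨p, hp⟩
  have hc : Continuous fun z => ((bdPhi h k p z : ℝ) : AddCircle (1 : ℝ)) :=
    (AddCircle.isCoveringMap_coe (1 : ℝ)).continuous.comp (bdPhi_cont h k p)
  exact hc.continuousOn.congr fun z hz => bdF_eq h k p (hcl p hp) z hz

lemma unitSquare_preconn (p : Cell) : IsPreconnected (unitSquare p) :=
  isPreconnected_Icc.prod isPreconnected_Icc

lemma corner_mem (p : Cell) : toR p ∈ unitSquare p ∧ toR (p + (1, 0)) ∈ unitSquare p ∧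
    toR (p + (0, 1)) ∈ unitSquare p ∧ toR (p + (1, 1)) ∈ unitSquare p := by
  simp [toR, unitSquare]

lemma bd_exact (S : Finset Cell) [ContractibleSpace (Region S)] (h k : Cell → ℤ)
    (hcl : ∀ p ∈ S, h p + k (p + (1, 0)) = k p + h (p + (0, 1))) :
    ∃ g : Cell → ℤ, ∀ p ∈ S, g (p + (1, 0)) - g p = h p ∧ g (p + (0, 1)) - g p = k p ∧
        g (p + (1, 1)) - g (p + (0, 1)) = h (p + (0, 1)) ∧
        g (p + (1, 1)) - g (p + (1, 0)) = k (p + (1, 0)) := by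
  classical
  obtain ⟨G, hG⟩ := bd_lift (X := Region S) ⟨_, (bdF_cont S h k hcl).domRestrict⟩
  let G' : ℝ × ℝ → ℝ := fun z => if hz : z ∈ Region S then G ⟨z, hz⟩ else 0
  have hG' : ∀ z (hz : z ∈ Region S), G' z = G ⟨z, hz⟩ := fun z hz => by simp [G', hz]
  have hGc : ContinuousOn G' (Region S) := by
    rw [continuousOn_iff_continuous_domRestrict]
    exact G.continuous.congr fun z => (hG' z z.2).symm
  have hGF : ∀ z ∈ Region S, ((G' z : ℝ) : AddCircle (1 : ℝ)) = bdF h k z := by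
    intro z hz
    rw [hG' z hz, hG]; rfl
  have hint : ∀ v : Cell, toR v ∈ Region S → ((⌊G' (toR v)⌋ : ℤ) : ℝ) = G' (toR v) := by
    intro v hv
    have := hGF _ hv
    have h0 : bdF h k (toR v) = ((0 : ℝ) : AddCircle (1 : ℝ)) := by
      simp [bdF, bdPhi, toR]
    rw [h0, bd_coe_eq] at this
    obtain ⟨n, hn⟩ := this
    rw [sub_zero] at hn
    rw [hn, Int.floor_intCast]
  refine ⟨fun v => ⌊G' (toR v)⌋, fun p hp => ?_⟩
  have hdisc : IsDiscrete (Set.range ((↑) : ℤ → ℝ)) :=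
    ⟨Int.isClosedEmbedding_coe_real.isEmbedding.toHomeomorph.symm.isEmbedding.discreteTopology⟩
  have hconst : ∀ z ∈ unitSquare p, ∀ w ∈ unitSquare p,
      G' z - bdPhi h k p z = G' w - bdPhi h k p w := by
    intro z hz w hw
    refine (unitSquare_preconn p).constant_of_mapsTo hdisc
      (f := fun z => G' z - bdPhi h k p z)
      ((hGc.mono (unitSquare_subset hp)).sub (bdPhi_cont h k p).continuousOn) ?_ hz hw
    intro z hz
    have := hGF z (unitSquare_subset hp hz)
    rw [bdF_eq h k p (hcl p hp) z hz, bd_coe_eq] at this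
    obtain ⟨n, hn⟩ := this
    exact ⟨n, hn.symm⟩
  obtain ⟨c1, c2, c3, c4⟩ := corner_mem p
  have i1 := hint _ (unitSquare_subset hp c1)
  have i2 := hint _ (unitSquare_subset hp c2)
  have i3 := hint _ (unitSquare_subset hp c3)
  have i4 := hint _ (unitSquare_subset hp c4)
  have d2 := hconst _ c2 _ c1
  have d3 := hconst _ c3 _ c1
  have d4 := hconst _ c4 _ c1
  have hpR : (h p : ℝ) + k (p + (1, 0)) = k p + h (p + (0, 1)) := by exact_mod_cast hcl p hp
  rw [← i1, ← i2] at d2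
  rw [← i1, ← i3] at d3
  rw [← i1, ← i4] at d4
  have q2 : ((⌊G' (toR (p + (1, 0)))⌋ : ℤ) : ℝ) - (⌊G' (toR p)⌋ : ℤ) = h p := by
    have : bdPhi h k p (toR (p + (1, 0))) - bdPhi h k p (toR p) = h p := by simp [bdPhi, toR]
    linarith
  have q3 : ((⌊G' (toR (p + (0, 1)))⌋ : ℤ) : ℝ) - (⌊G' (toR p)⌋ : ℤ) = k p := by
    have : bdPhi h k p (toR (p + (0, 1))) - bdPhi h k p (toR p) = k p := by simp [bdPhi, toR]
    linarith
  have q4 : ((⌊G' (toR (p + (1, 1)))⌋ : ℤ) : ℝ) - (⌊G' (toR p)⌋ : ℤ) = k p + h (p + (0, 1)) := by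
    have : bdPhi h k p (toR (p + (1, 1))) - bdPhi h k p (toR p) = k p + h (p + (0, 1)) := by
      simp [bdPhi, toR]; ring
    linarith
  have q2' : ⌊G' (toR (p + (1, 0)))⌋ - ⌊G' (toR p)⌋ = h p := by exact_mod_cast q2
  have q3' : ⌊G' (toR (p + (0, 1)))⌋ - ⌊G' (toR p)⌋ = k p := by exact_mod_cast q3
  have q4' : ⌊G' (toR (p + (1, 1)))⌋ - ⌊G' (toR p)⌋ = k p + h (p + (0, 1)) := by exact_mod_cast q4
  have := hcl p hp
  refine ⟨q2', q3', ?_, ?_⟩ <;> linarith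

lemma bd_conn (S : Finset Cell) (hpre : IsPreconnected (Region S)) (f : Cell → ℤ)
    (hf : ∀ p ∈ S, f (p + (1, 0)) = f p ∧ f (p + (0, 1)) = f p ∧ f (p + (1, 1)) = f p)
    (p : Cell) (hp : p ∈ S) (q : Cell) (hq : q ∈ S) : f p = f q := by
  classical
  by_contra hne
  rw [isPreconnected_closed_iff] at hpre
  have hcl : ∀ T : Finset Cell, IsClosed (Region T) := fun T =>
    T.finite_toSet.isClosed_biUnion fun i _ => unitSquare_closed i
  have cov : Region S ⊆ Region (S.filter fun r => f r = f p) ∪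
      Region (S.filter fun r => f r ≠ f p) := by
    intro z hz
    simp only [Region, Set.mem_iUnion] at hz
    obtain ⟨r, hr, hz⟩ := hz
    by_cases h : f r = f p
    · exact Or.inl (unitSquare_subset (by simp [hr, h]) hz)
    · exact Or.inr (unitSquare_subset (by simp [hr, h]) hz)
  obtain ⟨z, -, hz1, hz2⟩ := hpre _ _ (hcl _) (hcl _) cov
    ⟨toR p, unitSquare_subset hp (corner_mem p).1, unitSquare_subset (by simp [hp]) (corner_mem p).1⟩
    ⟨toR q, unitSquare_subset hq (corner_mem q).1,
      unitSquare_subset (by simp [hq, Ne.symm hne]) (corner_mem q).1⟩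
  simp only [Region, Set.mem_iUnion, Finset.mem_filter] at hz1 hz2
  obtain ⟨a, ⟨ha, hap⟩, hza⟩ := hz1
  obtain ⟨b, ⟨hb, hbp⟩, hzb⟩ := hz2
  apply hbp
  rw [← hap]
  simp only [unitSquare, Set.mem_prod, Set.mem_Icc] at hza hzb
  obtain ⟨⟨a1, a2⟩, a3, a4⟩ := hza
  obtain ⟨⟨b1, b2⟩, b3, b4⟩ := hzb
  have k1 : a.1 ≤ b.1 + 1 := by have : (a.1 : ℝ) ≤ b.1 + 1 := by linarith
                                exact_mod_cast this
  have k2 : b.1 ≤ a.1 + 1 := by have : (b.1 : ℝ) ≤ a.1 + 1 := by linarith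
                                exact_mod_cast this
  have k3 : a.2 ≤ b.2 + 1 := by have : (a.2 : ℝ) ≤ b.2 + 1 := by linarith
                                exact_mod_cast this
  have k4 : b.2 ≤ a.2 + 1 := by have : (b.2 : ℝ) ≤ a.2 + 1 := by linarith
                                exact_mod_cast this
  have key : ∀ c ∈ S, ∀ v : Cell, (v.1 = c.1 ∨ v.1 = c.1 + 1) → (v.2 = c.2 ∨ v.2 = c.2 + 1) →
      f v = f c := by
    rintro ⟨c1, c2⟩ hc ⟨v1, v2⟩ h1 h2
    have := hf _ hc
    simp only [Prod.mk_add_mk, add_zero] at this h1 h2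
    rcases h1 with rfl | rfl <;> rcases h2 with rfl | rfl <;> tauto
  rw [← key a ha (max a.1 b.1, max a.2 b.2) (by simp; omega) (by simp; omega),
    ← key b hb (max a.1 b.1, max a.2 b.2) (by simp; omega) (by simp; omega)]

lemma bd_no_sign_change (w : EuclideanSpace ℝ (Fin 2) → ℝ) (q a b : EuclideanSpace ℝ (Fin 2))
    (r : ℝ) (hw : ContinuousOn w (Metric.closedBall 0 1)) (hq : q ∈ Metric.closedBall 0 1)
    (hr : 0 < r) (hwq : w q = 0)
    (hnz : ∀ z ∈ Metric.closedBall 0 1, z ∈ Metric.ball q r → z ≠ q → w z ≠ 0)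
    (ha : a ∈ Metric.closedBall 0 1) (ha' : a ∈ Metric.ball q r)
    (hb : b ∈ Metric.closedBall 0 1) (hb' : b ∈ Metric.ball q r)
    (hwa : 0 < w a) (hwb : w b < 0) : False := by
  set D : Set (EuclideanSpace ℝ (Fin 2)) := Metric.closedBall 0 1 with hD
  have conv : Convex ℝ (D ∩ Metric.ball q r) := (convex_closedBall _ _).inter (convex_ball _ _)
  -- two points of opposite sign have `q` on their segment
  have seg : ∀ x ∈ D ∩ Metric.ball q r, ∀ y ∈ D ∩ Metric.ball q r, 0 < w x → w y < 0 →
      q ∈ segment ℝ x y := by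
    intro x hx y hy hwx hwy
    by_contra hqs
    have sub : segment ℝ x y ⊆ D ∩ Metric.ball q r := conv.segment_subset hx hy
    have := (convex_segment (𝕜 := ℝ) x y).isPreconnected.intermediate_value
      (right_mem_segment ℝ x y) (left_mem_segment ℝ x y)
      (hw.mono (sub.trans Set.inter_subset_left))
    obtain ⟨z, hz, hz0⟩ := this ⟨hwy.le, hwx.le⟩
    exact hnz z (sub hz).1 (sub hz).2 (fun h => hqs (h ▸ hz)) hz0
  have haq : a ≠ q := by rintro rfl; linarith
  have hbq : b ≠ q := by rintro rfl; linarith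
  let l : EuclideanSpace ℝ (Fin 2) → EuclideanSpace ℝ (Fin 2) → ℝ := fun x z =>
    (z 0 - q 0) * (x 1 - q 1) - (z 1 - q 1) * (x 0 - q 0)
  -- on a segment through `q`, the functional vanishes
  have lin : ∀ x y, x ≠ q → y ≠ q → q ∈ segment ℝ x y → l x y = 0 := by
    intro x y hx hy hqs
    obtain ⟨s, t, hs, ht, hst, he⟩ := hqs
    have h0 : s * x 0 + t * y 0 = q 0 := by rw [← he]; simp
    have h1 : s * x 1 + t * y 1 = q 1 := by rw [← he]; simp
    have ht0 : t ≠ 0 := by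
      rintro rfl
      apply hx
      have : s = 1 := by linarith
      subst this
      simpa using he
    have : t * l x y = 0 := by
      simp only [l]
      have hs' : s = 1 - t := by linarith
      subst hs'
      linear_combination (x 1 - q 1) * h0 - (x 0 - q 0) * h1
    exact (mul_eq_zero.1 this).resolve_left ht0
  -- a third point off the line
  obtain ⟨c, hc, hlc⟩ : ∃ c ∈ D ∩ Metric.ball q r, l a c ≠ 0 := by
    have hqc : q ∈ closure (Metric.ball (0 : EuclideanSpace ℝ (Fin 2)) 1) := by
      rw [closure_ball _ one_ne_zero]; exact hq
    obtain ⟨m, hm1, hm2⟩ := mem_closure_iff.1 hqc _ Metric.isOpen_ball (Metric.mem_ball_self hr)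
    by_cases hlm : l a m = 0
    · let n : EuclideanSpace ℝ (Fin 2) := !₂[a 1 - q 1, -(a 0 - q 0)]
      have hcont : Continuous fun ε : ℝ => m + ε • n := by fun_prop
      have hop : IsOpen (Metric.ball q r ∩ Metric.ball (0 : EuclideanSpace ℝ (Fin 2)) 1) :=
        Metric.isOpen_ball.inter Metric.isOpen_ball
      have hev : ∀ᶠ ε in nhds (0 : ℝ), m + ε • n ∈
          Metric.ball q r ∩ Metric.ball (0 : EuclideanSpace ℝ (Fin 2)) 1 := by
        apply hcont.continuousAt.eventually
        apply hop.mem_nhds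
        simpa using And.intro hm1 hm2
      have hev' := hev.filter_mono (nhdsWithin_le_nhds (s := Set.Ioi 0))
      obtain ⟨ε, ⟨h1, h2⟩, hε⟩ := (hev'.and self_mem_nhdsWithin).exists
      refine ⟨m + ε • n, ⟨Metric.ball_subset_closedBall h2, h1⟩, ?_⟩
      have : l a (m + ε • n) = ε * ((a 1 - q 1) ^ 2 + (a 0 - q 0) ^ 2) := by
        simp only [l] at hlm ⊢
        simp [n]
        linear_combination hlm
      rw [this]
      refine mul_ne_zero (ne_of_gt hε) ?_
      intro h0
      apply haq
      have e1 : a 1 - q 1 = 0 := by nlinarith [sq_nonneg (a 1 - q 1), sq_nonneg (a 0 - q 0)]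
      have e0 : a 0 - q 0 = 0 := by nlinarith [sq_nonneg (a 1 - q 1), sq_nonneg (a 0 - q 0)]
      ext i
      fin_cases i
      · simpa using sub_eq_zero.1 e0
      · simpa using sub_eq_zero.1 e1
    · exact ⟨m, ⟨Metric.ball_subset_closedBall hm2, hm1⟩, hlm⟩
  have hcq : c ≠ q := by
    rintro rfl
    apply hlc
    simp [l]
  have hab : l a b = 0 := lin a b haq hbq (seg a ⟨ha, ha'⟩ b ⟨hb, hb'⟩ hwa hwb)
  rcases lt_or_gt_of_ne (hnz c hc.1 hc.2 hcq) with hneg | hpos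
  · exact hlc (lin a c haq hcq (seg a ⟨ha, ha'⟩ c hc hwa hneg))
  · -- `q` lies on both `[a,b]` and `[c,b]`
    have hcb := seg c hc b ⟨hb, hb'⟩ hpos hwb
    have hab' := seg a ⟨ha, ha'⟩ b ⟨hb, hb'⟩ hwa hwb
    obtain ⟨s, t, hs, ht, hst, he⟩ := hcb
    have h0 : s * c 0 + t * b 0 = q 0 := by rw [← he]; simp
    have h1 : s * c 1 + t * b 1 = q 1 := by rw [← he]; simp
    have hs0 : s ≠ 0 := by
      rintro rfl
      apply hbq
      have : t = 1 := by linarith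
      subst this
      simpa using he
    apply hlc
    have : s * l a c = 0 := by
      simp only [l] at hab ⊢
      have ht' : t = 1 - s := by linarith
      subst ht'
      linear_combination (a 1 - q 1) * h0 - (a 0 - q 0) * h1 - (1 - s) * hab
    exact (mul_eq_zero.1 this).resolve_left hs0

lemma bd_no_pinch (S : Finset Cell)
    (φ : (Region S) ≃ₜ (Metric.closedBall (0 : EuclideanSpace ℝ (Fin 2)) 1))
    (v : Cell) (hb : v - (1, 0) ∈ S) (hc : v - (0, 1) ∈ S) (ha : v ∉ S) (hd : v - (1, 1) ∉ S) :
    False := by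
  classical
  obtain ⟨v1, v2⟩ := v
  simp only [Prod.mk_sub_mk, sub_zero] at hb hc hd
  have memb : ∀ ε : ℝ, 0 ≤ ε → ε ≤ 1 → ((v1 : ℝ) - ε, (v2 : ℝ) + ε) ∈ Region S := by
    intro ε h0 h1
    apply unitSquare_subset hb
    simp only [unitSquare, Set.mem_prod, Set.mem_Icc]; push_cast
    refine ⟨⟨?_, ?_⟩, ?_, ?_⟩ <;> linarith
  have memc : ∀ ε : ℝ, 0 ≤ ε → ε ≤ 1 → ((v1 : ℝ) + ε, (v2 : ℝ) - ε) ∈ Region S := by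
    intro ε h0 h1
    apply unitSquare_subset hc
    simp only [unitSquare, Set.mem_prod, Set.mem_Icc]; push_cast
    refine ⟨⟨?_, ?_⟩, ?_, ?_⟩ <;> linarith
  have hx0 : ((v1 : ℝ), (v2 : ℝ)) ∈ Region S := by simpa using memb 0 le_rfl zero_le_one
  let x0 : Region S := ⟨((v1 : ℝ), (v2 : ℝ)), hx0⟩
  let u : Region S → ℝ := fun z => (z.1.2 - v2) - (z.1.1 - v1)
  have hu : Continuous u := by fun_prop
  have hnear : ∀ z : Region S, dist z x0 < 1 → z ≠ x0 → u z ≠ 0 := by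
    rintro ⟨⟨x, y⟩, hz⟩ hdist hne hu0
    simp only [u] at hu0
    have hd' : |x - v1| < 1 ∧ |y - v2| < 1 := by
      rw [Subtype.dist_eq, Prod.dist_eq, max_lt_iff] at hdist
      simpa [x0, Real.dist_eq] using hdist
    obtain ⟨⟨hxl, hxr⟩, hyl, hyr⟩ := And.intro (abs_lt.1 hd'.1) (abs_lt.1 hd'.2)
    simp only [Region, Set.mem_iUnion] at hz
    obtain ⟨⟨p1, p2⟩, hp, hz⟩ := hz
    simp only [unitSquare, Set.mem_prod, Set.mem_Icc] at hz
    obtain ⟨⟨z1, z2⟩, z3, z4⟩ := hz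
    have hxne : x ≠ v1 := by
      rintro rfl
      apply hne
      simp only [x0, Subtype.mk.injEq, Prod.mk.injEq, true_and]
      linarith
    have b1 : p1 < v1 + 1 := by have : (p1 : ℝ) < v1 + 1 := by linarith
                                exact_mod_cast this
    have b2 : v1 - 2 < p1 := by have : (v1 : ℝ) - 2 < p1 := by linarith
                                exact_mod_cast this
    have b3 : p2 < v2 + 1 := by have : (p2 : ℝ) < v2 + 1 := by linarith
                                exact_mod_cast this
    have b4 : v2 - 2 < p2 := by have : (v2 : ℝ) - 2 < p2 := by linarith
                                exact_mod_cast this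
    have c1 : p1 = v1 ∨ p1 = v1 - 1 := by omega
    have c2 : p2 = v2 ∨ p2 = v2 - 1 := by omega
    rcases c1 with rfl | rfl <;> rcases c2 with rfl | rfl
    · exact ha hp
    · push_cast at z1 z2 z3 z4
      exact hxne (by linarith)
    · push_cast at z1 z2 z3 z4
      exact hxne (by linarith)
    · exact hd hp
  -- transport to the disk
  let w : EuclideanSpace ℝ (Fin 2) → ℝ := fun z =>
    if hz : z ∈ Metric.closedBall (0 : EuclideanSpace ℝ (Fin 2)) 1 then u (φ.symm ⟨z, hz⟩) else 0
  have hwv : ∀ z (hz : z ∈ Metric.closedBall (0 : EuclideanSpace ℝ (Fin 2)) 1),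
      w z = u (φ.symm ⟨z, hz⟩) := fun z hz => dif_pos hz
  have hwφ : ∀ x : Region S, w (φ x).1 = u x := by
    intro x
    rw [hwv _ (φ x).2]; simp
  have hwc : ContinuousOn w (Metric.closedBall 0 1) := by
    rw [continuousOn_iff_continuous_domRestrict]
    exact (hu.comp φ.symm.continuous).congr fun z => (hwv z z.2).symm
  obtain ⟨r, hr, hr'⟩ := Metric.continuousAt_iff.1 (φ.symm.continuous.continuousAt
    (x := φ x0)) 1 one_pos
  obtain ⟨δ, hδ, hδ'⟩ := Metric.continuousAt_iff.1 (φ.continuous.continuousAt (x := x0)) r hr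
  set ε : ℝ := min (δ / 2) (1 / 2) with hε
  have ε0 : 0 < ε := by rw [hε]; positivity
  have ε1 : ε ≤ 1 := (min_le_right _ _).trans (by norm_num)
  have εδ : ε < δ := (min_le_left _ _).trans_lt (by linarith)
  let A : Region S := ⟨_, memb ε ε0.le ε1⟩
  let B : Region S := ⟨_, memc ε ε0.le ε1⟩
  have dA : dist A x0 < δ := by
    rw [Subtype.dist_eq, Prod.dist_eq, max_lt_iff]
    simp [A, x0, Real.dist_eq, abs_of_pos ε0, εδ]
  have dB : dist B x0 < δ := by
    rw [Subtype.dist_eq, Prod.dist_eq, max_lt_iff]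
    simp [B, x0, Real.dist_eq, abs_of_pos ε0, εδ]
  refine bd_no_sign_change w (φ x0).1 (φ A).1 (φ B).1 r hwc (φ x0).2 hr ?_ ?_ (φ A).2 (hδ' dA)
    (φ B).2 (hδ' dB) ?_ ?_
  · rw [hwφ]; simp [u, x0]
  · intro z hz hzr hne
    rw [hwv z hz]
    apply hnear
    · have := hr' (x := ⟨z, hz⟩) hzr
      simpa using this
    · intro h
      apply hne
      rw [← h]; simp
  · rw [hwφ]; simp only [u, A]; linarith
  · rw [hwφ]; simp only [u, B]; linarith

/-- **Lemma.** For a board, the number of positive vertices exceeds the number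
of negative vertices by exactly `2`. -/
theorem positive_sub_negative_vertices_eq_two
    (S : Finset Cell) (hS : IsBoard S) :
    ({v : Cell | IsPositiveVertex S v}.ncard : ℤ)
      - ({v : Cell | IsNegativeVertex S v}.ncard : ℤ) = 2 := by
  obtain ⟨hne, ⟨φ⟩⟩ := hS
  have : ContractibleSpace (Metric.closedBall (0 : EuclideanSpace ℝ (Fin 2)) 1) :=
    Metric.contractibleSpace_closedBall zero_le_one
  have : ContractibleSpace (Region S) := φ.contractibleSpace
  have hpre : IsPreconnected (Region S) := isPreconnected_iff_preconnectedSpace.2 inferInstance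
  rw [combinatorial_count S (fun v => bd_no_pinch S φ v),
    euler_of_exact S hne (fun f hf => bd_conn S hpre f hf) (bd_exact S)]
  norm_num
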